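/- Fix c > 0, p > 0 and 0 < α < 2/(p+2). There is a sequence ε(n) → 0 (depending only on c, p, α) such that for every integer n ≥ 2 and every weighted graph G with a vertex o and a vertex set z satisfying dist(o,z) ≥ n and w_z/w_o ≤ c n^p: P[T_{oz} ≤ α n²/log n] < n^{−(α(p+2)−2)²/(8α) + ε(n)}. -/

import Mathlib

open MeasureTheory Filter
open scoped Classical ENNReal

namespace RWHitting

/-- A weighted graph on a vertex set `V`: a symmetric weight function with
positive finite vertex weights. -/
structure WeightedGraph (V : Type*) where
  w : V → V → ℝ≥0∞
  symm : ∀ x y, w x y = w y x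
  vw_pos : ∀ x, 0 < ∑' y, w x y
  vw_lt_top : ∀ x, ∑' y, w x y < ⊤

namespace WeightedGraph

variable {V : Type*}

/-- The weight of a vertex. -/
noncomputable def vw (G : WeightedGraph V) (x : V) : ℝ≥0∞ := ∑' y, G.w x y

/-- The weight of a vertex set. -/
noncomputable def setWeight (G : WeightedGraph V) (z : Set V) : ℝ≥0∞ := ∑' x : z, G.vw x

/-- `G.distGE o z m` : every path of positive-weight steps from `o` into `z` has length `≥ m`. -/
def distGE (G : WeightedGraph V) (o : V) (z : Set V) (m : ℕ) : Prop :=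
  ∀ (k : ℕ) (p : ℕ → V), p 0 = o → (∀ i, i < k → 0 < G.w (p i) (p (i+1))) → p k ∈ z → m ≤ k

/-- Transition probabilities of the random walk on `G`. -/
noncomputable def trans (G : WeightedGraph V) (x y : V) : ℝ≥0∞ := G.w x y / G.vw x

/-- Graph distance (as an extended nonneg real). -/
noncomputable def edist (G : WeightedGraph V) (x y : V) : ℝ≥0∞ :=
  ⨅ (k : ℕ) (_ : ∃ p : ℕ → V, p 0 = x ∧ p k = y ∧ ∀ i, i < k → 0 < G.w (p i) (p (i+1))),
    (k : ℝ≥0∞)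

/-- Total weight of the edges at distance `n` from `o` (each non-loop edge counted in both
orientations). -/
noncomputable def boundaryWeight (G : WeightedGraph V) (o : V) (n : ℕ) : ℝ≥0∞ :=
  ∑' q : V × V, if min (G.edist o q.1) (G.edist o q.2) = (n : ℝ≥0∞) then G.w q.1 q.2 else 0

end WeightedGraph

variable {V : Type*}

/-- `μ` is the law of the random walk on `G` started at `o`. -/
def IsRandomWalk [MeasurableSpace V] (G : WeightedGraph V) (o : V)
    (μ : Measure (ℕ → V)) : Prop :=
  IsProbabilityMeasure μ ∧
  ∀ (k : ℕ) (x : Fin (k+1) → V),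
    μ {ω | ∀ i : Fin (k+1), ω (i : ℕ) = x i}
      = (if x 0 = o then 1 else 0) * ∏ i : Fin k, G.trans (x i.castSucc) (x i.succ)

/-- First hitting time of the set `z` (`∞` if `z` is never visited). -/
noncomputable def hitTime (z : Set V) (ω : ℕ → V) : ℝ≥0∞ :=
  ⨅ (k : ℕ) (_ : ω k ∈ z), (k : ℝ≥0∞)

/-- Expected hitting time of `z`. -/
noncomputable def expHit [MeasurableSpace V] (μ : Measure (ℕ → V)) (z : Set V) : ℝ≥0∞ :=
  ∫⁻ ω, hitTime z ω ∂μ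

/-- Number of visits to `o` (counting time 0) strictly before hitting `z`. -/
noncomputable def visitsBefore (z : Set V) (o : V) (ω : ℕ → V) : ℝ≥0∞ :=
  ∑' k : ℕ, if ω k = o ∧ (k : ℝ≥0∞) < hitTime z ω then 1 else 0

/-- Effective resistance between `o` and `z`, defined probabilistically via the random walk
law `μ`:  `w_o r_{oz}` is the expected number of visits to `o` before hitting `z`. -/
noncomputable def resistance [MeasurableSpace V] (G : WeightedGraph V) (o : V) (z : Set V)
    (μ : Measure (ℕ → V)) : ℝ≥0∞ :=
  (∫⁻ ω, visitsBefore z o ω ∂μ) / G.vw o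

/-- One-step transition probabilities for the biased simple random walk on `ℤ`
with odds `1 : g` of going left/right. -/
noncomputable def biasedStep (g : ℝ) (a b : ℤ) : ℝ≥0∞ :=
  if b = a + 1 then ENNReal.ofReal (g / (g+1))
  else if b = a - 1 then ENNReal.ofReal (1 / (g+1)) else 0

/-- `ν` is the law of the biased simple random walk on `ℤ` started at `0`,
stepping right with probability `g/(g+1)` and left with probability `1/(g+1)`. -/
def IsBiasedWalk (g : ℝ) (ν : Measure (ℕ → ℤ)) : Prop :=
  IsProbabilityMeasure ν ∧
  ∀ (k : ℕ) (x : Fin (k+1) → ℤ),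
    ν {ω | ∀ i : Fin (k+1), ω (i : ℕ) = x i}
      = (if x 0 = 0 then 1 else 0) * ∏ i : Fin k, biasedStep g (x i.castSucc) (x i.succ)

/-- `e^{-λ t}` for an extended-real time `t`, with the convention `e^{-λ ∞} = 0`. -/
noncomputable def expNeg (lam : ℝ) (t : ℝ≥0∞) : ℝ≥0∞ :=
  if t = ⊤ then 0 else ENNReal.ofReal (Real.exp (-lam * t.toReal))


section Entropy

open Real

lemma two_mul_le_log_sub_log {x : ℝ} (hx : 0 ≤ x) (hx1 : x < 1) :
    2 * x ≤ log (1 + x) - log (1 - x) := by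
  have h := Real.hasSum_log_sub_log_of_abs_lt_one (abs_lt.2 ⟨by linarith, hx1⟩)
  have := sum_le_hasSum {0} (fun i _ => by positivity) h
  simpa using this

/-- The binary entropy function minus its quadratic part is monotone in the bias. -/
lemma monotoneOn_entropy_sub_sq :
    MonotoneOn (fun u : ℝ => (1 + u) * log (1 + u) + (1 - u) * log (1 - u) - u ^ 2)
      (Set.Icc 0 1) := by
  have hd : ∀ u ∈ Set.Ioo (0 : ℝ) 1, HasDerivAt
      (fun u : ℝ => (1 + u) * log (1 + u) + (1 - u) * log (1 - u) - u ^ 2)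
      (log (1 + u) - log (1 - u) - 2 * u) u := by
    rintro u ⟨h0, h1⟩
    have e1 := (Real.hasDerivAt_mul_log (x := 1 + u) (by linarith)).comp u
      ((hasDerivAt_id u).const_add 1)
    have e2 := (Real.hasDerivAt_mul_log (x := 1 - u) (by linarith)).comp u
      ((hasDerivAt_id u).const_sub 1)
    refine ((e1.add e2).sub (hasDerivAt_pow 2 u)).congr_deriv ?_
    push_cast
    ring
  refine monotoneOn_of_deriv_nonneg (convex_Icc 0 1) ?_ ?_ ?_
  · have c1 : Continuous fun u : ℝ => (1 + u) * log (1 + u) :=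
      Real.continuous_mul_log.comp (by fun_prop : Continuous fun u : ℝ => 1 + u)
    have c2 : Continuous fun u : ℝ => (1 - u) * log (1 - u) :=
      Real.continuous_mul_log.comp (by fun_prop : Continuous fun u : ℝ => 1 - u)
    exact ((c1.add c2).sub (continuous_pow 2)).continuousOn
  · intro u hu
    rw [interior_Icc] at hu
    exact (hd u hu).differentiableAt.differentiableWithinAt
  · intro u hu
    rw [interior_Icc] at hu
    rw [(hd u hu).deriv]
    linarith [two_mul_le_log_sub_log hu.1.le hu.2]

lemma sq_le_entropy_sub_entropy {ρ u : ℝ} (hρ : 0 ≤ ρ) (hρ1 : ρ ≤ 1) (hu : -1 ≤ u)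
    (hu1 : u ≤ 1) :
    (1 - ρ ^ 2) * u ^ 2 ≤ (1 + u) * log (1 + u) + (1 - u) * log (1 - u)
      - ((1 + ρ * u) * log (1 + ρ * u) + (1 - ρ * u) * log (1 - ρ * u)) := by
  have key : ∀ v : ℝ, 0 ≤ v → v ≤ 1 → (1 - ρ ^ 2) * v ^ 2 ≤
      (1 + v) * log (1 + v) + (1 - v) * log (1 - v)
      - ((1 + ρ * v) * log (1 + ρ * v) + (1 - ρ * v) * log (1 - ρ * v)) := by
    intro v h0 h1
    have h2 : ρ * v ≤ v := mul_le_of_le_one_left h0 hρ1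
    have := monotoneOn_entropy_sub_sq ⟨mul_nonneg hρ h0, h2.trans h1⟩ ⟨h0, h1⟩ h2
    simp only at this
    nlinarith
  rcases le_total 0 u with h | h
  · exact key u h hu1
  · have := key (-u) (by linarith) (by linarith)
    simp only [mul_neg, sub_neg_eq_add, ← sub_eq_add_neg, neg_sq] at this
    linarith

lemma mul_log_div_le {a X : ℝ} (ha : 0 ≤ a) (hX : 0 ≤ X) (h : 0 < a → 0 < X) :
    a * log (X / a) ≤ X - a := by
  rcases ha.eq_or_lt with rfl | ha
  · simpa using hX
  · have := Real.log_le_sub_one_of_pos (div_pos (h ha) ha)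
    calc a * log (X / a) ≤ a * (X / a - 1) := by gcongr
      _ = X - a := by field_simp

/-- The entropy inequality for a single edge crossed `a` times forwards and `b` times backwards. -/
lemma edge_entropy_le {ρ a b X Y : ℝ} (hρ : 0 ≤ ρ) (hρ1 : ρ ≤ 1) (ha : 0 ≤ a) (hb : 0 ≤ b)
    (hX : 0 ≤ X) (hY : 0 ≤ Y) (h : 0 < a + b → 0 < X ∧ 0 < Y) :
    a * log (X / a) + b * log (Y / b) ≤ X + Y - a - b
      + (1 - ρ) / 2 * ((a - b) * (log X - log Y))
      - (1 - ρ ^ 2) * ((a - b) ^ 2 / (2 * (a + b))) := by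
  rcases (add_nonneg ha hb).eq_or_lt with h0 | h0
  · have : a = 0 := by linarith
    have : b = 0 := by linarith
    subst_vars
    simp
    positivity
  obtain ⟨hX, hY⟩ := h h0
  set m := (a + b) / 2 with hm
  have hm0 : 0 < m := by positivity
  set u := (a - b) / (a + b) with hu
  have ea : a = m * (1 + u) := by rw [hm, hu]; field_simp; ring
  have eb : b = m * (1 - u) := by rw [hm, hu]; field_simp; ring
  have hu1 : u ≤ 1 := by rw [hu, div_le_one h0]; linarith
  have hu2 : -1 ≤ u := by rw [hu, le_div_iff₀ h0]; linarith
  have hent := sq_le_entropy_sub_entropy hρ hρ1 hu2 hu1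
  have hA : 0 ≤ 1 + ρ * u := by nlinarith
  have hB : 0 ≤ 1 - ρ * u := by nlinarith
  have split : ∀ {c Z : ℝ}, 0 ≤ c → 0 < Z → m * c * log (Z / (m * c))
      = m * c * log Z - m * c * log m - m * (c * log c) := by
    intro c Z hc hZ
    rcases hc.eq_or_lt with rfl | hc
    · simp
    · rw [log_div hZ.ne' (by positivity), log_mul hm0.ne' hc.ne']; ring
  have tA := mul_log_div_le (a := m * (1 + ρ * u)) (by positivity) hX.le (fun _ => hX)
  have tB := mul_log_div_le (a := m * (1 - ρ * u)) (by positivity) hY.le (fun _ => hY)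
  rw [split hA hX] at tA
  rw [split hB hY] at tB
  have hq : (a - b) ^ 2 / (2 * (a + b)) = m * u ^ 2 := by rw [hm, hu]; field_simp
  rw [hq]
  rw [ea, eb, split (by linarith) hX, split (by linarith) hY]
  have := mul_le_mul_of_nonneg_left hent hm0.le
  nlinarith

/-- The entropy bound for a unit flow `N` from `o` to the complement of `A`, whose potential
differences along `d` add up to at least `n`. -/
lemma flow_entropy_le {B : Type*} [Fintype B] [DecidableEq B] {A : Finset B} {o : B} (ho : o ∈ A)
    {w N : B → B → ℝ} {vw d : B → ℝ} {W t n ρ : ℝ} (hρ : 0 ≤ ρ) (hρ1 : ρ ≤ 1)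
    (hw : ∀ x y, 0 ≤ w x y) (hsymm : ∀ x y, w x y = w y x) (hvw : ∀ x, 0 < vw x)
    (hrow : ∀ x, ∑ y, w x y ≤ vw x) (hN : ∀ x y, 0 ≤ N x y) (hNA : ∀ x y, x ∉ A → N x y = 0)
    (hNw : ∀ x y, 0 < N x y → 0 < w x y)
    (hflow : ∀ g : B → ℝ, (∀ y, y ∉ A → g y = 0) → ∑ x, ∑ y, N x y * (g x - g y) = g o)
    (hd : ∀ x y, 0 < w x y → |d y - d x| ≤ 1) (hn : 1 ≤ n)
    (hdn : n ≤ ∑ x, ∑ y, N x y * (d y - d x)) (ht : ∑ x, ∑ y, N x y ≤ t)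
    (hW : ∑ x ∈ A, ∑ y ∈ Aᶜ, w x y ≤ W) :
    ∑ x, ∑ y, N x y * log (w x y * ((∑ y, N x y) / vw x) / N x y) ≤
      (1 - ρ) / 2 * (log (t * (W / vw o)) + 1) - (1 - ρ ^ 2) * (n - 1) ^ 2 / (2 * t) := by
  have split : ∀ f : B → B → ℝ, (∀ x y, x ∉ A → f x y = 0) → ∑ x, ∑ y, f x y
      = ∑ x ∈ A, ∑ y ∈ A, f x y + ∑ x ∈ A, ∑ y ∈ Aᶜ, f x y := by
    intro f hf
    simp only [← Finset.sum_add_distrib, Finset.sum_add_sum_compl]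
    exact (Finset.sum_subset (Finset.subset_univ A) fun x _ hx =>
      Finset.sum_eq_zero fun y _ => hf x y hx).symm
  set M : B → ℝ := fun x => ∑ y, N x y with hM
  set μ : B → ℝ := fun x => M x / vw x with hμ
  set θ : ℝ := (1 - ρ) / 2 with hθ
  have hθ0 : 0 ≤ θ := by rw [hθ]; linarith
  have hM0 : ∀ x, 0 ≤ M x := fun x => Finset.sum_nonneg fun y _ => hN x y
  have hμ0 : ∀ x, 0 ≤ μ x := fun x => div_nonneg (hM0 x) (hvw x).le
  have hbal : ∀ x ∈ A, M x = (∑ y, N y x) + if x = o then 1 else 0 := by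
    intro x hx
    have := hflow (fun y => if y = x then 1 else 0) (by
      intro y hy
      exact if_neg (ne_of_mem_of_not_mem hx hy).symm)
    simp only [mul_sub, mul_ite, mul_one, mul_zero, Finset.sum_sub_distrib, Finset.sum_ite_eq',
      Finset.mem_univ, if_true] at this
    rw [Finset.sum_comm] at this
    simp only [Finset.sum_ite_eq', Finset.mem_univ, if_true, eq_comm (a := o)] at this
    linarith
  have hμout : ∀ x y, 0 < N x y → 0 < μ x := fun x y h =>
    div_pos (h.trans_le (Finset.single_le_sum (fun y _ => hN x y) (Finset.mem_univ y))) (hvw x)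
  have hμin : ∀ x y, y ∈ A → 0 < N x y → 0 < μ y := by
    intro x y hy h
    refine div_pos ?_ (hvw y)
    rw [hbal y hy]
    have := Finset.single_le_sum (f := fun x => N x y) (fun x _ => hN x y) (Finset.mem_univ x)
    split_ifs <;> linarith
  have hMo : 1 ≤ M o := by
    rw [hbal o ho, if_pos rfl]
    linarith [Finset.sum_nonneg fun y (_ : y ∈ Finset.univ) => hN y o]
  have hMt : M o ≤ t :=
    (Finset.single_le_sum (fun x _ => hM0 x) (Finset.mem_univ o)).trans ht
  have ht0 : 0 < t := by linarith
  set s : ℝ := (n - 1) / t with hs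
  have hs0 : 0 ≤ s := div_nonneg (by linarith) ht0.le
  -- the edges inside `A`
  have hint : ∀ x ∈ A, ∀ y ∈ A,
      N x y * log (w x y * μ x / N x y) + N y x * log (w y x * μ y / N y x) ≤
      (w x y * μ x - N x y + θ * (N x y * (log (μ x) - log (μ y)))
        - (1 - ρ ^ 2) / 2 * (2 * s * (N x y * (d y - d x)) - s ^ 2 * N x y)) +
      (w y x * μ y - N y x + θ * (N y x * (log (μ y) - log (μ x)))
        - (1 - ρ ^ 2) / 2 * (2 * s * (N y x * (d x - d y)) - s ^ 2 * N y x)) := by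
    intro x hx y hy
    rcases (add_nonneg (hN x y) (hN y x)).eq_or_lt with h0 | h0
    · have h1 : N x y = 0 := by linarith [hN x y, hN y x]
      have h2 : N y x = 0 := by linarith [hN x y, hN y x]
      simp only [h1, h2]
      have := mul_nonneg (hw x y) (hμ0 x)
      have := mul_nonneg (hw y x) (hμ0 y)
      linarith
    have hpos : 0 < w x y ∧ 0 < μ x ∧ 0 < μ y := by
      by_cases h : 0 < N x y
      · exact ⟨hNw x y h, hμout x y h, hμin x y hy h⟩
      · have h : 0 < N y x := by linarith [hN x y]
        exact ⟨hsymm x y ▸ hNw y x h, hμin y x hx h, hμout y x h⟩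
    obtain ⟨hw0, hx0, hy0⟩ := hpos
    have hE := edge_entropy_le hρ hρ1 (hN x y) (hN y x) (mul_pos hw0 hx0).le (mul_pos hw0 hy0).le
      (fun _ => ⟨mul_pos hw0 hx0, mul_pos hw0 hy0⟩)
    rw [log_mul hw0.ne' hx0.ne', log_mul hw0.ne' hy0.ne'] at hE
    have hδ := sq_le_one_iff_abs_le_one (d y - d x) |>.2 (hd x y hw0)
    have hK : 2 * s * ((N x y - N y x) * (d y - d x)) - s ^ 2 * (N x y + N y x) ≤
        2 * ((N x y - N y x) ^ 2 / (2 * (N x y + N y x))) := by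
      have h1 : (N x y - N y x) ^ 2 / (2 * (N x y + N y x)) * (2 * (N x y + N y x))
          = (N x y - N y x) ^ 2 := div_mul_cancel₀ _ (by positivity)
      set q := (N x y - N y x) ^ 2 / (2 * (N x y + N y x))
      refine le_of_mul_le_mul_right ?_ h0
      have h2 : 0 ≤ s ^ 2 * (N x y + N y x) ^ 2 * (1 - (d y - d x) ^ 2) :=
        mul_nonneg (by positivity) (by linarith)
      nlinarith [sq_nonneg ((N x y - N y x) - s * (N x y + N y x) * (d y - d x))]
    have hρ2 : 0 ≤ 1 - ρ ^ 2 := by nlinarith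
    have hK' := mul_le_mul_of_nonneg_left hK hρ2
    rw [← hsymm x y]
    linear_combination hE + hK' / 2
  have hint' : ∑ x ∈ A, ∑ y ∈ A, N x y * log (w x y * μ x / N x y) ≤
      ∑ x ∈ A, ∑ y ∈ A, (w x y * μ x - N x y + θ * (N x y * (log (μ x) - log (μ y)))
        - (1 - ρ ^ 2) / 2 * (2 * s * (N x y * (d y - d x)) - s ^ 2 * N x y)) := by
    have h := Finset.sum_le_sum fun x hx => Finset.sum_le_sum (hint x hx)
    simp only [Finset.sum_add_distrib] at h
    rw [Finset.sum_comm (f := fun x y => N y x * log (w y x * μ y / N y x)),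
      Finset.sum_comm (f := fun x y => w y x * μ y - N y x
        + θ * (N y x * (log (μ y) - log (μ x)))
        - (1 - ρ ^ 2) / 2 * (2 * s * (N y x * (d x - d y)) - s ^ 2 * N y x))] at h
    linarith
  -- the unit of flow leaving `A`
  have hexit : ∑ x ∈ A, ∑ y ∈ Aᶜ, N x y = 1 := by
    have h := hflow (fun y => if y ∈ A then 1 else 0) (by intro y hy; simp [hy])
    rw [split _ (by intro x y hx; simp [hNA x y hx]), if_pos ho] at h
    rw [Finset.sum_eq_zero (s := A), zero_add] at h
    · rw [← h]
      refine Finset.sum_congr rfl fun x hx => Finset.sum_congr rfl fun y hy => ?_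
      simp [hx, Finset.mem_compl.1 hy]
    · intro x hx
      exact Finset.sum_eq_zero fun y hy => by simp [hx, hy]
  have hW0 : 0 < W := by
    refine lt_of_lt_of_le ?_ hW
    obtain ⟨x, hx, h⟩ := Finset.exists_ne_zero_of_sum_ne_zero (hexit.trans_ne one_ne_zero)
    obtain ⟨y, hy, h⟩ := Finset.exists_ne_zero_of_sum_ne_zero h
    exact Finset.sum_pos' (fun x _ => Finset.sum_nonneg fun y _ => hw x y)
      ⟨x, hx, Finset.sum_pos' (fun y _ => hw x y)
        ⟨y, hy, hNw x y ((hN x y).lt_of_ne' h)⟩⟩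
  have hbdry : ∀ x ∈ A, ∀ y ∈ Aᶜ, N x y * log (w x y * μ x / N x y) ≤
      θ * (N x y * log (μ x)) + (1 - θ) * (w x y * μ x - N x y)
        + θ * (N x y * log W + w x y / W - N x y) := by
    intro x hx y hy
    have hθ1 : 0 ≤ 1 - θ := by rw [hθ]; linarith
    rcases (hN x y).eq_or_lt with h | h
    · rw [← h]
      have h1 := mul_nonneg hθ1 (mul_nonneg (hw x y) (hμ0 x))
      have h2 := mul_nonneg hθ0 (div_nonneg (hw x y) hW0.le)
      linarith
    · have hw0 := hNw x y h
      have hx0 := hμout x y h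
      have h1 := mul_le_mul_of_nonneg_left (mul_log_div_le (hN x y) (mul_pos hw0 hx0).le
        (fun _ => mul_pos hw0 hx0)) hθ1
      have h2 := mul_le_mul_of_nonneg_left (mul_log_div_le (hN x y) (div_pos hw0 hW0).le
        (fun _ => div_pos hw0 hW0)) hθ0
      rw [log_div (mul_pos hw0 hx0).ne' h.ne', log_mul hw0.ne' hx0.ne'] at h1 ⊢
      rw [log_div (div_pos hw0 hW0).ne' h.ne', log_div hw0.ne' hW0.ne'] at h2
      linear_combination h1 + h2
  have hbdry' := Finset.sum_le_sum fun x hx => Finset.sum_le_sum (hbdry x hx)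
  have hlog : ∑ x ∈ A, ∑ y ∈ A, N x y * (log (μ x) - log (μ y))
      + ∑ x ∈ A, ∑ y ∈ Aᶜ, N x y * log (μ x) = log (μ o) := by
    have h := hflow (fun y => if y ∈ A then log (μ y) else 0) (by intro y hy; simp [hy])
    rw [split _ (by intro x y hx; simp [hNA x y hx]), if_pos ho] at h
    rw [← h]
    congr 1
    · exact Finset.sum_congr rfl fun x hx => Finset.sum_congr rfl fun y hy => by simp [hx, hy]
    · exact Finset.sum_congr rfl fun x hx => Finset.sum_congr rfl fun y hy => by
        simp [hx, Finset.mem_compl.1 hy]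
  have hmass : ∑ x ∈ A, ∑ y ∈ A, w x y * μ x + ∑ x ∈ A, ∑ y ∈ Aᶜ, w x y * μ x ≤
      ∑ x ∈ A, ∑ y ∈ A, N x y + ∑ x ∈ A, ∑ y ∈ Aᶜ, N x y := by
    simp only [← Finset.sum_add_distrib, Finset.sum_add_sum_compl]
    refine Finset.sum_le_sum fun x _ => ?_
    rw [← Finset.sum_mul]
    calc (∑ y, w x y) * μ x ≤ vw x * μ x := mul_le_mul_of_nonneg_right (hrow x) (hμ0 x)
      _ = M x := mul_div_cancel₀ _ (hvw x).ne'
  rw [split _ (by intro x y hx; simp [hNA x y hx]), hexit] at ht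
  have hdint : n - 1 ≤ ∑ x ∈ A, ∑ y ∈ A, N x y * (d y - d x) := by
    rw [split _ (by intro x y hx; simp [hNA x y hx])] at hdn
    have : ∑ x ∈ A, ∑ y ∈ Aᶜ, N x y * (d y - d x) ≤ ∑ x ∈ A, ∑ y ∈ Aᶜ, N x y := by
      refine Finset.sum_le_sum fun x _ => Finset.sum_le_sum fun y _ => ?_
      rcases (hN x y).eq_or_lt with h | h
      · simp [← h]
      · exact mul_le_of_le_one_right (hN x y) (le_of_abs_le (hd x y (hNw x y h)))
    linarith
  have hexitμ : 0 ≤ ∑ x ∈ A, ∑ y ∈ Aᶜ, w x y * μ x :=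
    Finset.sum_nonneg fun x _ => Finset.sum_nonneg fun y _ => mul_nonneg (hw x y) (hμ0 x)
  have hWone : ∑ x ∈ A, ∑ y ∈ Aᶜ, w x y / W ≤ 1 := by
    simp only [← Finset.sum_div]
    exact (div_le_one hW0).2 hW
  have hμo : log (μ o) + log W ≤ log (t * (W / vw o)) := by
    have h1 : 0 < μ o := div_pos (by linarith) (hvw o)
    rw [← log_mul h1.ne' hW0.ne']
    refine log_le_log (mul_pos h1 hW0) ?_
    have := mul_le_mul_of_nonneg_right hMt (div_nonneg hW0.le (hvw o).le)
    calc μ o * W = M o * (W / vw o) := by simp only [hμ]; ring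
      _ ≤ _ := this
  rw [split _ (by intro x y hx; simp [hNA x y hx])]
  simp only [Finset.sum_add_distrib, Finset.sum_sub_distrib, ← Finset.mul_sum,
    ← Finset.sum_mul] at hint' hbdry' hlog hexitμ hmass hWone hdint ⊢
  rw [hexit] at hbdry' hmass
  have hρ2 : 0 ≤ 1 - ρ ^ 2 := by nlinarith
  have hquad : (1 - ρ ^ 2) * (n - 1) ^ 2 / (2 * t) ≤ (1 - ρ ^ 2) / 2 *
      (2 * s * ∑ x ∈ A, ∑ y ∈ A, N x y * (d y - d x) - s ^ 2 * ∑ x ∈ A, ∑ y ∈ A, N x y) := by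
    have e : (1 - ρ ^ 2) * (n - 1) ^ 2 / (2 * t)
        = (1 - ρ ^ 2) / 2 * (2 * s * (n - 1) - s ^ 2 * t) := by
      rw [hs]; field_simp; ring
    rw [e]
    refine mul_le_mul_of_nonneg_left ?_ (by linarith)
    have := mul_le_mul_of_nonneg_left hdint (by linarith : 0 ≤ 2 * s)
    have := mul_le_mul_of_nonneg_left (by linarith : ∑ x ∈ A, ∑ y ∈ A, N x y ≤ t) (sq_nonneg s)
    linarith
  linear_combination hint' + hbdry' + θ * hlog + hmass + θ * hexitμ + θ * hWone + θ * hμo + hquad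

/-- The kernel `p`, stopped when it leaves `A`. -/
def stoppedKernel {B : Type*} [DecidableEq B] (A : Finset B) (p : B → B → ℝ) (x y : B) : ℝ :=
  if x ∈ A then p x y else if x = y then 1 else 0

/-- The weight of the path `γ` for the transition kernel `p`. -/
def pathWeight {B : Type*} (p : B → B → ℝ) {t : ℕ} (γ : Fin (t + 1) → B) : ℝ :=
  ∏ i : Fin t, p (γ i.castSucc) (γ i.succ)

lemma sum_pathWeight_le_one {B : Type*} [Fintype B] [DecidableEq B] {r : B → B → ℝ}
    (hr : ∀ x y, 0 ≤ r x y) (hrow : ∀ x, ∑ y, r x y ≤ 1) (t : ℕ) (o : B) :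
    ∑ γ : Fin (t + 1) → B, (if γ 0 = o then pathWeight r γ else 0) ≤ 1 := by
  induction t generalizing o with
  | zero =>
    rw [← (Equiv.funUnique (Fin 1) B).symm.sum_comp]
    simp [pathWeight]
  | succ t ih =>
    rw [← (Fin.consEquiv (fun _ => B)).sum_comp, Fintype.sum_prod_type]
    simp only [Fin.consEquiv_apply, Fin.cons_zero]
    rw [Finset.sum_eq_single o (by intro b _ hb; simp [hb]) (by simp)]
    have : ∀ γ : Fin (t + 1) → B, pathWeight r (Fin.cons o γ : Fin (t + 2) → B)
        = ∑ y, r o y * (if γ 0 = y then pathWeight r γ else 0) := by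
      intro γ
      rw [pathWeight, Fin.prod_univ_succ]
      simp only [mul_ite, mul_zero, Finset.sum_ite_eq, Finset.mem_univ, if_true]
      rfl
    simp only [if_true]
    change ∑ γ : Fin (t + 1) → B, pathWeight r (Fin.cons o γ : Fin (t + 2) → B) ≤ 1
    simp only [this]
    rw [Finset.sum_comm]
    simp only [← Finset.mul_sum]
    exact (Finset.sum_le_sum fun y _ => mul_le_of_le_one_right (hr o y) (ih y)).trans (hrow o)

lemma sum_mul_log_div_le {ι : Type*} {S : Finset ι} {P R : ι → ℝ} {Z : ℝ} (hZ : 0 < Z)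
    (hP : ∀ i ∈ S, 0 ≤ P i) (hR : ∀ i ∈ S, 0 < P i → 0 < R i) (hR0 : ∀ i ∈ S, 0 ≤ R i)
    (hPZ : ∑ i ∈ S, P i = Z) (hR1 : ∑ i ∈ S, R i ≤ 1) :
    log Z ≤ ∑ i ∈ S, P i / Z * log (P i / R i) := by
  have h : ∀ i ∈ S, P i / Z * log Z ≤ P i / Z * log (P i / R i) + (R i - P i / Z) := by
    intro i hi
    rcases (hP i hi).eq_or_lt with h0 | h0
    · rw [← h0]
      simpa using hR0 i hi
    · have hRi := hR i hi h0
      have := mul_log_div_le (div_pos h0 hZ).le hRi.le fun _ => hRi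
      rw [log_div hRi.ne' (div_pos h0 hZ).ne', log_div h0.ne' hZ.ne'] at this
      rw [log_div h0.ne' hRi.ne']
      linarith
  have h' := Finset.sum_le_sum h
  simp only [Finset.sum_add_distrib, Finset.sum_sub_distrib, ← Finset.sum_mul,
    ← Finset.sum_div, hPZ, div_self hZ.ne'] at h'
  linarith

/-- A bound on the probability that a walk confined to a finite set leaves `A` by time `t`. -/
lemma log_sum_pathWeight_le {B : Type*} [Fintype B] [DecidableEq B] {A : Finset B} {o : B}
    (ho : o ∈ A) {w : B → B → ℝ} {vw d : B → ℝ} {W n ρ : ℝ} (hρ : 0 ≤ ρ) (hρ1 : ρ ≤ 1)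
    (hw : ∀ x y, 0 ≤ w x y) (hsymm : ∀ x y, w x y = w y x) (hvw : ∀ x, 0 < vw x)
    (hrow : ∀ x, ∑ y, w x y ≤ vw x)
    (hd : ∀ x y, 0 < w x y → |d y - d x| ≤ 1) (hn : 1 ≤ n) (hdo : d o = 0)
    (hdA : ∀ x, x ∉ A → n ≤ d x) (hW : ∑ x ∈ A, ∑ y ∈ Aᶜ, w x y ≤ W) (t : ℕ) {Z : ℝ}
    (hZ : ∑ γ : Fin (t + 1) → B with γ 0 = o ∧ γ (Fin.last t) ∉ A,
      pathWeight (stoppedKernel A fun x y => w x y / vw x) γ = Z) (hZ0 : 0 < Z) :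
    log Z ≤ (1 - ρ) / 2 * (log (t * (W / vw o)) + 1)
      - (1 - ρ ^ 2) * (n - 1) ^ 2 / (2 * t) := by
  set q := stoppedKernel A fun x y => w x y / vw x with hq
  set S : Finset (Fin (t + 1) → B) := {γ | γ 0 = o ∧ γ (Fin.last t) ∉ A} with hS
  have hq0 : ∀ x y, 0 ≤ q x y := by
    intro x y
    have := div_nonneg (hw x y) (hvw x).le
    simp only [hq, stoppedKernel]
    split_ifs <;> first | assumption | norm_num
  have hP0 : ∀ γ : Fin (t + 1) → B, 0 ≤ pathWeight q γ :=
    fun γ => Finset.prod_nonneg fun i _ => hq0 _ _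
  set Q : (Fin (t + 1) → B) → ℝ := fun γ => pathWeight q γ / Z with hQ
  have hQ0 : ∀ γ, 0 ≤ Q γ := fun γ => div_nonneg (hP0 γ) hZ0.le
  have hQ1 : ∑ γ ∈ S, Q γ = 1 := by rw [← Finset.sum_div, hZ, div_self hZ0.ne']
  have hQq : ∀ γ, 0 < Q γ → ∀ i : Fin t, 0 < q (γ i.castSucc) (γ i.succ) := by
    intro γ h i
    refine (hq0 _ _).lt_of_ne' fun h0 => h.ne' ?_
    rw [hQ]
    simp only [pathWeight]
    rw [Finset.prod_eq_zero (Finset.mem_univ i) h0, zero_div]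
  -- expected numbers of crossings
  set N : B → B → ℝ := fun x y => ∑ γ ∈ S, Q γ * ∑ i : Fin t,
    if x ∈ A ∧ γ i.castSucc = x ∧ γ i.succ = y then 1 else 0 with hNdef
  have hN0 : ∀ x y, 0 ≤ N x y := fun x y => Finset.sum_nonneg fun γ _ =>
    mul_nonneg (hQ0 γ) (Finset.sum_nonneg fun i _ => by split_ifs <;> norm_num)
  have hNsum : ∀ f : B → B → ℝ, ∑ x, ∑ y, N x y * f x y = ∑ γ ∈ S, Q γ * ∑ i : Fin t,
      if γ i.castSucc ∈ A then f (γ i.castSucc) (γ i.succ) else 0 := by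
    intro f
    simp only [hNdef, Finset.sum_mul, Finset.mul_sum]
    simp_rw [Finset.sum_comm (s := (Finset.univ : Finset B)) (t := S)]
    refine Finset.sum_congr rfl fun γ _ => ?_
    simp_rw [Finset.sum_comm (s := (Finset.univ : Finset B)) (t := (Finset.univ : Finset (Fin t)))]
    refine Finset.sum_congr rfl fun i _ => ?_
    rw [Finset.sum_eq_single (γ i.castSucc), Finset.sum_eq_single (γ i.succ)]
    · split_ifs <;> simp_all
    · intro y _ hy
      simp [hy.symm]
    · simp
    · intro x _ hx
      simp [hx.symm]
    · simp
  have hNA : ∀ x y, x ∉ A → N x y = 0 := fun x y hx =>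
    Finset.sum_eq_zero fun γ _ => by simp [hx]
  have hNpos : ∀ γ ∈ S, 0 < Q γ → ∀ i : Fin t, γ i.castSucc ∈ A →
      0 < N (γ i.castSucc) (γ i.succ) := by
    intro γ hγ h i hi
    refine Finset.sum_pos' (fun γ _ => mul_nonneg (hQ0 γ)
      (Finset.sum_nonneg fun i _ => by split_ifs <;> norm_num)) ⟨γ, hγ, mul_pos h ?_⟩
    exact Finset.sum_pos' (fun i _ => by split_ifs <;> norm_num)
      ⟨i, Finset.mem_univ i, by simp [hi]⟩
  have hNw : ∀ x y, 0 < N x y → 0 < w x y := by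
    intro x y h
    obtain ⟨γ, hγ, h⟩ := Finset.exists_ne_zero_of_sum_ne_zero h.ne'
    have hγ0 : 0 < Q γ := (hQ0 γ).lt_of_ne' (left_ne_zero_of_mul h)
    obtain ⟨i, -, hi⟩ := Finset.exists_ne_zero_of_sum_ne_zero (right_ne_zero_of_mul h)
    obtain ⟨hx, rfl, rfl⟩ : x ∈ A ∧ γ i.castSucc = x ∧ γ i.succ = y := by
      by_contra hc
      simp [hc] at hi
    have := hQq γ hγ0 i
    simp only [hq, stoppedKernel, hx, if_true] at this
    exact (div_pos_iff_of_pos_right (hvw _)).1 this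
  have htel : ∀ g : B → ℝ, ∑ x, ∑ y, N x y * (g x - g y)
      = ∑ γ ∈ S, Q γ * (g o - g (γ (Fin.last t))) := by
    intro g
    rw [hNsum]
    refine Finset.sum_congr rfl fun γ hγ => ?_
    rcases (hQ0 γ).eq_or_lt with h | h
    · simp [← h]
    congr 1
    have h1 : ∀ i : Fin t, (if γ i.castSucc ∈ A then g (γ i.castSucc) - g (γ i.succ) else 0)
        = g (γ i.castSucc) - g (γ i.succ) := by
      intro i
      split_ifs with hi
      · rfl
      · have := hQq γ h i
        simp only [hq, stoppedKernel, hi, if_false] at this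
        split_ifs at this with he
        · simp [he]
        · exact absurd this (lt_irrefl _)
    simp only [h1, Finset.sum_sub_distrib]
    have h2 := Fin.sum_univ_succ fun i => g (γ i)
    have h3 := Fin.sum_univ_castSucc fun i => g (γ i)
    rw [(Finset.mem_filter.1 hγ).2.1] at h2
    linarith
  have hflow : ∀ g : B → ℝ, (∀ y, y ∉ A → g y = 0) →
      ∑ x, ∑ y, N x y * (g x - g y) = g o := by
    intro g hg
    rw [htel]
    calc ∑ γ ∈ S, Q γ * (g o - g (γ (Fin.last t))) = ∑ γ ∈ S, Q γ * g o :=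
          Finset.sum_congr rfl fun γ hγ => by rw [hg _ (Finset.mem_filter.1 hγ).2.2, sub_zero]
      _ = g o := by rw [← Finset.sum_mul, hQ1, one_mul]
  have hdn : n ≤ ∑ x, ∑ y, N x y * (d y - d x) := by
    have h := htel fun x => - d x
    simp only [neg_sub_neg, hdo, sub_zero] at h
    rw [h, ← one_mul n, ← hQ1, Finset.sum_mul]
    exact Finset.sum_le_sum fun γ hγ =>
      mul_le_mul_of_nonneg_left (hdA _ (Finset.mem_filter.1 hγ).2.2) (hQ0 γ)
  have ht : ∑ x, ∑ y, N x y ≤ t := by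
    have h := hNsum fun _ _ => 1
    simp only [mul_one] at h
    refine h.trans_le ((Finset.sum_le_sum (g := fun γ => Q γ * t) fun γ _ =>
      mul_le_mul_of_nonneg_left ?_ (hQ0 γ)).trans_eq
        (by rw [← Finset.sum_mul, hQ1, one_mul]))
    calc ∑ i : Fin t, (if γ i.castSucc ∈ A then (1 : ℝ) else 0)
        ≤ ∑ i : Fin t, (1 : ℝ) := Finset.sum_le_sum fun i _ => by split_ifs <;> norm_num
      _ = t := by simp
  refine le_trans ?_
    (flow_entropy_le ho hρ hρ1 hw hsymm hvw hrow hN0 hNA hNw hflow hd hn hdn ht hW)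
  set r := stoppedKernel A fun x y => N x y / ∑ y, N x y with hr
  have hM0 : ∀ x, 0 ≤ ∑ y, N x y := fun x => Finset.sum_nonneg fun y _ => hN0 x y
  have hr0 : ∀ x y, 0 ≤ r x y := by
    intro x y
    have := div_nonneg (hN0 x y) (hM0 x)
    simp only [hr, stoppedKernel]
    split_ifs <;> first | assumption | norm_num
  have hr1 : ∀ x, ∑ y, r x y ≤ 1 := by
    intro x
    by_cases hx : x ∈ A
    · simp only [hr, stoppedKernel, hx, if_true, ← Finset.sum_div]
      exact div_self_le_one _
    · simp [hr, stoppedKernel, hx]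
  have hrpos : ∀ γ ∈ S, 0 < Q γ → ∀ i : Fin t, 0 < r (γ i.castSucc) (γ i.succ) := by
    intro γ hγ h i
    by_cases hi : γ i.castSucc ∈ A
    · have hp := hNpos γ hγ h i hi
      simp only [hr, stoppedKernel, hi, if_true]
      exact div_pos hp (hp.trans_le
        (Finset.single_le_sum (fun y _ => hN0 _ y) (Finset.mem_univ (γ i.succ))))
    · have := hQq γ h i
      simp only [hq, hr, stoppedKernel, hi, if_false] at this ⊢
      exact this
  have hGibbs := sum_mul_log_div_le (S := S) (P := pathWeight q) (R := pathWeight r) hZ0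
    (fun γ _ => hP0 γ)
    (fun γ hγ h => Finset.prod_pos fun i _ => hrpos γ hγ (div_pos h hZ0) i)
    (fun γ _ => Finset.prod_nonneg fun i _ => hr0 _ _) hZ (by
      refine le_trans ?_ (sum_pathWeight_le_one hr0 hr1 t o)
      rw [← Finset.sum_filter]
      exact Finset.sum_le_sum_of_subset_of_nonneg
        (fun γ hγ => by simpa using (Finset.mem_filter.1 hγ).2.1)
        (fun γ _ _ => Finset.prod_nonneg fun i _ => hr0 _ _))
  refine hGibbs.trans (le_of_eq ?_)
  rw [hNsum fun x y => log (w x y * ((∑ y, N x y) / vw x) / N x y)]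
  refine Finset.sum_congr rfl fun γ hγ => ?_
  rcases (hQ0 γ).eq_or_lt with h | h
  · simp only [hQ] at h ⊢
    simp [← h]
  congr 1
  simp only [pathWeight]
  rw [← Finset.prod_div_distrib, log_prod fun i _ =>
    (div_pos (hQq γ h i) (hrpos γ hγ h i)).ne']
  refine Finset.sum_congr rfl fun i _ => ?_
  split_ifs with hi
  · simp only [hq, hr, stoppedKernel, hi, if_true]
    congr 1
    rw [div_div_eq_mul_div]
    ring
  · have := hQq γ h i
    simp only [hq, hr, stoppedKernel, hi, if_false] at this ⊢
    split_ifs at this ⊢ with he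
    · simp
    · exact absurd this (lt_irrefl _)

end Entropy

section Distance

variable (G : WeightedGraph V) (o : V) (n : ℕ)

/-- The graph distance from `o`, truncated at `n`. -/
noncomputable def truncDist (x : V) : ℕ :=
  sInf ({k | ∃ p : ℕ → V, p 0 = o ∧ (∀ i < k, 0 < G.w (p i) (p (i + 1))) ∧ p k = x} ∪ {n})

lemma truncDist_self : truncDist G o n o = 0 :=
  Nat.le_zero.1 (Nat.sInf_le (Or.inl ⟨fun _ => o, rfl, by simp, rfl⟩))

variable {G o n}

lemma truncDist_le_succ {x y : V} (h : 0 < G.w x y) :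
    truncDist G o n y ≤ truncDist G o n x + 1 := by
  have hx : truncDist G o n x ∈ _ := Nat.sInf_mem ⟨n, Or.inr rfl⟩
  rcases hx with ⟨p, h0, hp, hpx⟩ | hx
  · refine Nat.sInf_le (Or.inl ⟨fun i => if i ≤ truncDist G o n x then p i else y, ?_, ?_, ?_⟩)
    · simp [h0]
    · intro i hi
      rcases (Nat.lt_succ_iff.1 hi).eq_or_lt with h' | h'
      · simpa [h', hpx] using h
      · simpa [h'.le, Nat.succ_le_of_lt h'] using hp i h'
    · simp
  · rw [hx]
    exact (Nat.sInf_le (Or.inr rfl)).trans n.le_succ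

lemma abs_truncDist_sub_le {x y : V} (h : 0 < G.w x y) :
    |(truncDist G o n y : ℝ) - truncDist G o n x| ≤ 1 := by
  have h1 : (truncDist G o n y : ℝ) ≤ truncDist G o n x + 1 := by
    exact_mod_cast truncDist_le_succ h
  have h2 : (truncDist G o n x : ℝ) ≤ truncDist G o n y + 1 := by
    exact_mod_cast truncDist_le_succ (G.symm x y ▸ h)
  rw [abs_le]
  constructor <;> linarith

lemma le_truncDist {z : Set V} (hz : G.distGE o z n) {x : V} (hx : x ∈ z) :
    n ≤ truncDist G o n x := by
  refine le_csInf ⟨n, Or.inr rfl⟩ ?_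
  rintro k (⟨p, h0, hp, rfl⟩ | rfl)
  · exact hz k p h0 hp hx
  · exact le_rfl

end Distance

lemma WeightedGraph.w_ne_top (G : WeightedGraph V) (x y : V) : G.w x y ≠ ⊤ :=
  ((ENNReal.le_tsum y).trans_lt (G.vw_lt_top x)).ne

lemma WeightedGraph.vw_ne_top (G : WeightedGraph V) (x : V) : G.vw x ≠ ⊤ :=
  (G.vw_lt_top x).ne

lemma WeightedGraph.vw_toReal_pos (G : WeightedGraph V) (x : V) : 0 < (G.vw x).toReal :=
  ENNReal.toReal_pos (G.vw_pos x).ne' (G.vw_ne_top x)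

lemma sum_edges_le_setWeight (G : WeightedGraph V) (z : Set V) (B : Finset V) :
    ∑ x : B with x.1 ∉ z, ∑ y ∈ ({x : B | x.1 ∉ z} : Finset B)ᶜ, G.w x y ≤ G.setWeight z := by
  rw [Finset.sum_comm]
  calc ∑ y ∈ ({x : B | x.1 ∉ z} : Finset B)ᶜ, ∑ x : B with x.1 ∉ z, G.w x y
      ≤ ∑ y ∈ ({x : B | x.1 ∉ z} : Finset B)ᶜ, z.indicator G.vw y.1 := by
        refine Finset.sum_le_sum fun y hy => ?_
        have hy : y.1 ∈ z := by simpa using hy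
        rw [Set.indicator_of_mem hy]
        simp only [G.symm _ y.1]
        refine le_trans ?_ (ENNReal.sum_le_tsum B)
        rw [← Finset.sum_coe_sort B]
        exact Finset.sum_le_sum_of_subset (Finset.subset_univ _)
    _ ≤ ∑ y : B, z.indicator G.vw y.1 := Finset.sum_le_sum_of_subset (Finset.subset_univ _)
    _ = ∑ y ∈ B, z.indicator G.vw y := Finset.sum_coe_sort B _
    _ ≤ ∑' y, z.indicator G.vw y := ENNReal.sum_le_tsum B
    _ = G.setWeight z := (tsum_subtype z G.vw).symm

lemma measure_hit_within_le [MeasurableSpace V] {G : WeightedGraph V} {o : V}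
    {μ : Measure (ℕ → V)} (hμ : IsRandomWalk G o μ) (z : Set V) (t : ℕ) {B : Finset V}
    (hoB : o ∈ B) :
    μ {ω | ∃ k ≤ t, ω k ∈ z ∧ ∀ i ≤ k, ω i ∈ B} ≤ ENNReal.ofReal
      (∑ γ : Fin (t + 1) → B with γ 0 = ⟨o, hoB⟩ ∧
        γ (Fin.last t) ∉ ({x : B | x.1 ∉ z} : Finset B),
        pathWeight (stoppedKernel ({x : B | x.1 ∉ z} : Finset B)
          fun x y => (G.w x y).toReal / (G.vw x).toReal) γ) := by
  set q := stoppedKernel ({x : B | x.1 ∉ z} : Finset B)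
    fun x y => (G.w x y).toReal / (G.vw x).toReal with hq
  have hP0 : ∀ γ : Fin (t + 1) → B, 0 ≤ pathWeight q γ := by
    refine fun γ => Finset.prod_nonneg fun i _ => ?_
    simp only [hq, stoppedKernel]
    split_ifs <;> positivity
  set cell : (Fin (t + 1) → B) → Set (ℕ → V) := fun γ =>
    {ω | ∃ k ≤ t, ω k ∈ z ∧ (∀ i < k, ω i ∉ z) ∧ ∀ i : Fin (t + 1), (γ i : V) = ω (min i k)}
    with hcell
  have hcover : {ω : ℕ → V | ∃ k ≤ t, ω k ∈ z ∧ ∀ i ≤ k, ω i ∈ B}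
      ⊆ ⋃ γ ∈ (Finset.univ : Finset (Fin (t + 1) → B)), cell γ := by
    rintro ω ⟨k, hk, hkz, hkB⟩
    have hex : ∃ k, ω k ∈ z := ⟨k, hkz⟩
    have hle : Nat.find hex ≤ k := Nat.find_min' hex hkz
    simp only [Set.mem_iUnion]
    exact ⟨fun i => ⟨ω (min i (Nat.find hex)), hkB _ ((min_le_right _ _).trans hle)⟩,
      Finset.mem_univ _, Nat.find hex, hle.trans hk, Nat.find_spec hex,
      fun i hi => Nat.find_min hex hi, fun i => rfl⟩
  have hmeas : ∀ γ, μ (cell γ) ≤ ENNReal.ofReal (if γ 0 = ⟨o, hoB⟩ ∧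
      γ (Fin.last t) ∉ ({x : B | x.1 ∉ z} : Finset B) then pathWeight q γ else 0) := by
    intro γ
    rcases (cell γ).eq_empty_or_nonempty with he | ⟨ω₀, k, hk, hkz, hkmin, hγ⟩
    · simp [he]
    have hγk : ∀ i (hi : i ≤ k), (γ ⟨i, by omega⟩ : V) = ω₀ i := fun i hi => by
      rw [hγ, min_eq_left hi]
    have hsub : cell γ ⊆ {ω | ∀ i : Fin (k + 1), ω (i : ℕ) = ω₀ i} := by
      rintro ω ⟨k', hk', hkz', hkmin', hγ'⟩ i
      have hkk : k' = k := by
        rcases lt_trichotomy k' k with h | h | h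
        · have := hγ' ⟨k', by omega⟩
          rw [hγk k' h.le, min_self] at this
          exact absurd (this ▸ hkz') (hkmin k' h)
        · exact h
        · have := hγ' ⟨k, by omega⟩
          rw [hγk k le_rfl, min_eq_left h.le] at this
          exact absurd (this ▸ hkz) (hkmin' k h)
      have hi : (i : ℕ) ≤ k := Nat.lt_succ_iff.1 i.2
      have := hγ' ⟨i, by omega⟩
      rw [hγk i hi] at this
      simpa [hkk, hi] using this.symm
    refine (measure_mono hsub).trans ?_
    rw [hμ.2 k fun i => ω₀ i]
    have hlast : γ (Fin.last t) ∉ ({x : B | x.1 ∉ z} : Finset B) := by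
      have := hγ (Fin.last t)
      rw [Fin.val_last, min_eq_right hk] at this
      simp [this, hkz]
    by_cases h0 : ω₀ 0 = o
    · have hγ0 : γ 0 = ⟨o, hoB⟩ := Subtype.ext ((hγk 0 (Nat.zero_le k)).trans h0)
      rw [if_pos (show ω₀ ((0 : Fin (k + 1)) : ℕ) = o from h0), one_mul, if_pos (And.intro hγ0 hlast)]
      have hprod : pathWeight q γ = ∏ i ∈ Finset.range k,
          ((G.w (ω₀ i) (ω₀ (i + 1))).toReal / (G.vw (ω₀ i)).toReal) := by
        have h1 : pathWeight q γ = ∏ i ∈ Finset.range t, if ω₀ (min i k) ∉ z then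
            (G.w (ω₀ (min i k)) (ω₀ (min (i + 1) k))).toReal / (G.vw (ω₀ (min i k))).toReal
            else if ω₀ (min i k) = ω₀ (min (i + 1) k) then 1 else 0 := by
          rw [Finset.prod_range, pathWeight]
          refine Finset.prod_congr rfl fun i _ => ?_
          simp [hq, stoppedKernel, hγ, Subtype.ext_iff]
        rw [h1, ← Finset.prod_subset (Finset.range_subset_range.2 hk)]
        · refine Finset.prod_congr rfl fun i hi => ?_
          have hi := Finset.mem_range.1 hi
          rw [min_eq_left hi.le, min_eq_left (Nat.succ_le_of_lt hi), if_pos (hkmin i hi)]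
        · intro i _ hi
          have hi : k ≤ i := by simpa using hi
          rw [min_eq_right hi, min_eq_right (by omega), if_neg (not_not.2 hkz), if_pos rfl]
      rw [hprod, ENNReal.ofReal_prod_of_nonneg fun i _ => by positivity, Finset.prod_range]
      refine Finset.prod_le_prod' fun i _ => le_of_eq ?_
      rw [ENNReal.ofReal_div_of_pos (G.vw_toReal_pos _), ENNReal.ofReal_toReal (G.w_ne_top _ _),
        ENNReal.ofReal_toReal (G.vw_ne_top _)]
      rfl
    · simp [h0]
  calc μ {ω | ∃ k ≤ t, ω k ∈ z ∧ ∀ i ≤ k, ω i ∈ B}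
      ≤ ∑ γ, μ (cell γ) := (measure_mono hcover).trans (measure_biUnion_finset_le _ _)
    _ ≤ ∑ γ, ENNReal.ofReal (if γ 0 = ⟨o, hoB⟩ ∧
        γ (Fin.last t) ∉ ({x : B | x.1 ∉ z} : Finset B) then pathWeight q γ else 0) :=
      Finset.sum_le_sum fun γ _ => hmeas γ
    _ = _ := by
      rw [Finset.sum_filter, ENNReal.ofReal_sum_of_nonneg]
      intro γ _
      split_ifs
      exacts [hP0 γ, le_rfl]

/-- A non-asymptotic bound on the probability of hitting `z` by time `t`, with a free
parameter `ρ`. -/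
lemma measure_hit_le [Countable V] [MeasurableSpace V] {G : WeightedGraph V} {o : V}
    {μ : Measure (ℕ → V)} (hμ : IsRandomWalk G o μ) {z : Set V} {n t : ℕ} (hn : 1 ≤ n)
    (hz : G.distGE o z n) {T C ρ : ℝ} (hρ : 0 ≤ ρ) (hρ1 : ρ ≤ 1) (htT : t ≤ T) (hC : 0 < C)
    (hW : G.setWeight z / G.vw o ≤ ENNReal.ofReal C) :
    μ {ω | ∃ k ≤ t, ω k ∈ z} ≤ ENNReal.ofReal (Real.exp
      ((1 - ρ) / 2 * (Real.log (T * C) + 1) - (1 - ρ ^ 2) * (n - 1) ^ 2 / (2 * T))) := by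
  have hoz : o ∉ z := fun h => by
    have := hz 0 (fun _ => o) rfl (by simp) h
    omega
  have hset : {ω : ℕ → V | ∃ k ≤ t, ω k ∈ z}
      = ⋃ B : Finset V, {ω | ∃ k ≤ t, ω k ∈ z ∧ ∀ i ≤ k, ω i ∈ insert o B} := by
    ext ω
    simp only [Set.mem_ofPred_eq, Set.mem_iUnion]
    constructor
    · rintro ⟨k, hk, hkz⟩
      exact ⟨(Finset.range (k + 1)).image ω, k, hk, hkz, fun i hi => Finset.mem_insert_of_mem
        (Finset.mem_image_of_mem ω (Finset.mem_range.2 (Nat.lt_succ_of_le hi)))⟩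
    · rintro ⟨B, k, hk, hkz, -⟩
      exact ⟨k, hk, hkz⟩
  have hmono : Monotone fun B : Finset V =>
      {ω : ℕ → V | ∃ k ≤ t, ω k ∈ z ∧ ∀ i ≤ k, ω i ∈ insert o B} := by
    rintro B B' h ω ⟨k, hk, hkz, hkB⟩
    exact ⟨k, hk, hkz, fun i hi => Finset.insert_subset_insert o h (hkB i hi)⟩
  rw [hset, hmono.directed_le.measure_iUnion]
  refine iSup_le fun B => ?_
  have hoB := Finset.mem_insert_self o B
  refine (measure_hit_within_le hμ z t hoB).trans (ENNReal.ofReal_le_ofReal ?_)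
  generalize hZ : Finset.sum (M := ℝ) (ι := Fin (t + 1) → (insert o B : Finset V)) _ _ = Z
  rcases le_or_gt Z 0 with hZ0 | hZ0
  · exact hZ0.trans (Real.exp_pos _).le
  rw [← Real.log_le_iff_le_exp hZ0]
  have ht : 1 ≤ t := by
    by_contra! h
    obtain rfl : t = 0 := by omega
    refine hZ0.ne (Eq.trans ?_ hZ)
    symm
    refine Finset.sum_eq_zero fun γ hγ => ?_
    obtain ⟨-, h1, h2⟩ := Finset.mem_filter.1 hγ
    exact absurd (by rw [Fin.last_zero, h1]; simpa using hoz) h2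
  have ht0 : (1 : ℝ) ≤ t := by exact_mod_cast ht
  have hvo := G.vw_toReal_pos o
  have hWC : G.setWeight z ≤ ENNReal.ofReal (C * (G.vw o).toReal) := by
    rw [ENNReal.ofReal_mul hC.le, ENNReal.ofReal_toReal (G.vw_ne_top o)]
    exact (ENNReal.div_le_iff (G.vw_pos o).ne' (G.vw_ne_top o)).1 hW
  have key := log_sum_pathWeight_le (A := ({x | x.1 ∉ z} : Finset (insert o B : Finset V)))
    (o := ⟨o, hoB⟩) (by simpa using hoz) (w := fun x y => (G.w x y).toReal)
    (vw := fun x => (G.vw x).toReal) (d := fun x => (truncDist G o n x : ℝ))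
    (W := C * (G.vw o).toReal) (n := n) hρ hρ1
    (fun _ _ => ENNReal.toReal_nonneg) (fun x y => by rw [G.symm]) (fun x => G.vw_toReal_pos x)
    (fun x => by
      rw [← ENNReal.toReal_sum fun (y : (insert o B : Finset V)) _ => G.w_ne_top x.1 y.1]
      refine ENNReal.toReal_mono (G.vw_ne_top x) ?_
      rw [Finset.sum_coe_sort (insert o B) fun y => G.w x y]
      exact ENNReal.sum_le_tsum _)
    (fun x y h => abs_truncDist_sub_le (ENNReal.toReal_pos_iff.1 h).1)
    (by exact_mod_cast hn) (by simp [truncDist_self])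
    (fun x hx => by exact_mod_cast le_truncDist hz (not_not.1 fun h =>
      hx (Finset.mem_filter.2 ⟨Finset.mem_univ _, h⟩)))
    (by
      rw [Finset.sum_congr rfl fun (x : (insert o B : Finset V)) _ =>
          (ENNReal.toReal_sum fun (y : (insert o B : Finset V)) _ => G.w_ne_top x.1 y.1).symm,
        ← ENNReal.toReal_sum fun (x : (insert o B : Finset V)) _ =>
          ENNReal.sum_ne_top.2 fun (y : (insert o B : Finset V)) _ => G.w_ne_top x.1 y.1]
      exact ENNReal.toReal_le_of_le_ofReal (by positivity)
        ((sum_edges_le_setWeight G z _).trans hWC))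
    t hZ hZ0
  simp only [mul_div_cancel_right₀ C hvo.ne'] at key
  have h1 : Real.log (t * C) ≤ Real.log (T * C) :=
    Real.log_le_log (by positivity) (by gcongr)
  have h2 : (1 - ρ ^ 2) * (n - 1 : ℝ) ^ 2 / (2 * T) ≤ (1 - ρ ^ 2) * (n - 1 : ℝ) ^ 2 / (2 * t) := by
    have : 0 ≤ 1 - ρ ^ 2 := by nlinarith
    gcongr
  have h3 := mul_le_mul_of_nonneg_left h1 (by linarith : 0 ≤ (1 - ρ) / 2)
  linarith

lemma exists_mem_of_hitTime_le {z : Set V} {ω : ℕ → V} {s : ℝ}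
    (h : hitTime z ω ≤ ENNReal.ofReal s) : ∃ k ≤ ⌊s⌋₊, ω k ∈ z := by
  by_contra! hk
  have h1 : ((⌊s⌋₊ + 1 : ℕ) : ℝ≥0∞) ≤ hitTime z ω :=
    le_iInf₂ fun k hkz => Nat.cast_le.2 (not_le.1 fun h => hk k h hkz)
  have h2 : ENNReal.ofReal s < ((⌊s⌋₊ + 1 : ℕ) : ℝ≥0∞) := by
    rw [← ENNReal.ofReal_natCast]
    refine (ENNReal.ofReal_lt_ofReal_iff (by positivity)).2 ?_
    push_cast
    exact Nat.lt_floor_add_one s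
  exact absurd (h1.trans h) (not_le.2 h2)

/-- The logarithm of the bound at time `α n² / log n`, with the optimal parameter. -/
noncomputable def hitExponent (c p α : ℝ) (n : ℕ) : ℝ :=
  (1 - α * (p + 2) / 2) / 2 * (Real.log (α * n ^ 2 / Real.log n * (c * (n : ℝ) ^ p)) + 1)
    - (1 - (α * (p + 2) / 2) ^ 2) * (n - 1 : ℝ) ^ 2 / (2 * (α * n ^ 2 / Real.log n))

lemma tendsto_hitExponent_div_log {c p α : ℝ} (hc : 0 < c) (hα : 0 < α) :
    Tendsto (fun n : ℕ => hitExponent c p α n / Real.log n) atTop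
      (nhds (-(α * (p + 2) - 2) ^ 2 / (8 * α))) := by
  have hlog : Tendsto (fun n : ℕ => Real.log n) atTop atTop :=
    Real.tendsto_log_atTop.comp tendsto_natCast_atTop_atTop
  have h1 : Tendsto (fun n : ℕ => (Real.log α + Real.log c + 1) / Real.log n) atTop (nhds 0) :=
    hlog.const_div_atTop _
  have h2 : Tendsto (fun n : ℕ => Real.log (Real.log n) / Real.log n) atTop (nhds 0) :=
    (Real.isLittleO_log_id_atTop.tendsto_div_nhds_zero).comp hlog
  have h3 : Tendsto (fun n : ℕ => (1 - 1 / (n : ℝ)) ^ 2) atTop (nhds 1) := by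
    simpa using ((tendsto_one_div_atTop_nhds_zero_nat (𝕜 := ℝ)).const_sub 1).pow 2
  have h := (((h1.const_add (p + 2)).sub h2).const_mul ((1 - α * (p + 2) / 2) / 2)).sub
    (h3.const_mul ((1 - (α * (p + 2) / 2) ^ 2) / (2 * α)))
  have e : (1 - α * (p + 2) / 2) / 2 * (p + 2 + 0 - 0)
      - (1 - (α * (p + 2) / 2) ^ 2) / (2 * α) * 1 = -(α * (p + 2) - 2) ^ 2 / (8 * α) := by
    field_simp
    ring
  rw [e] at h
  refine h.congr' ?_
  filter_upwards [eventually_ge_atTop 2] with n hn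
  have hn0 : (0 : ℝ) < n := by positivity
  have hl : 0 < Real.log n := Real.log_pos (by exact_mod_cast hn)
  rw [hitExponent, Real.log_mul (by positivity) (by positivity),
    Real.log_div (by positivity) hl.ne', Real.log_mul hα.ne' (by positivity),
    Real.log_mul hc.ne' (by positivity), Real.log_pow, Real.log_rpow hn0]
  push_cast
  field_simp
  ring

/-- Uniform polynomial-scaling large deviation bound: there is a sequence
`ε(n) → 0` (depending only on `c, p, α`) such that every weighted graph with
`dist(o,z) ≥ n` and `w_z/w_o ≤ c n^p` (for `n ≥ 2`) has
`P[T_{oz} ≤ α n²/log n] < n^{-(α(p+2)-2)²/(8α) + ε(n)}`. -/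
theorem hitting_probability_polynomial_bound
    (c p α : ℝ) (hc : 0 < c) (hp : 0 < p) (hα : 0 < α) (hα' : α < 2 / (p + 2)) :
    ∃ ε : ℕ → ℝ, Tendsto ε atTop (nhds 0) ∧
      ∀ n : ℕ, 2 ≤ n →
        ∀ (V : Type) (_ : Countable V) (_ : MeasurableSpace V), MeasurableSingletonClass V →
          ∀ (G : WeightedGraph V) (o : V) (z : Set V) (μ : Measure (ℕ → V)),
            IsRandomWalk G o μ → G.distGE o z n →
            G.setWeight z / G.vw o ≤ ENNReal.ofReal (c * (n : ℝ) ^ p) →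
            μ {ω | hitTime z ω ≤ ENNReal.ofReal (α * n ^ 2 / Real.log n)}
              < ENNReal.ofReal ((n : ℝ) ^ (-(α * (p + 2) - 2) ^ 2 / (8 * α) + ε n)) := by
  have hαp : α * (p + 2) < 2 := (lt_div_iff₀ (by linarith)).1 hα'
  have hρ : 0 ≤ α * (p + 2) / 2 := by positivity
  refine ⟨fun n => hitExponent c p α n / Real.log n
    - -(α * (p + 2) - 2) ^ 2 / (8 * α) + 1 / (n : ℝ), ?_, ?_⟩
  · have h := ((tendsto_hitExponent_div_log (p := p) hc hα).sub_const
      (-(α * (p + 2) - 2) ^ 2 / (8 * α))).add tendsto_one_div_atTop_nhds_zero_nat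
    rwa [sub_self, zero_add] at h
  intro n hn V _ _ _ G o z μ hμ hz hW
  have hn0 : (0 : ℝ) < n := by positivity
  have hl : 0 < Real.log n := Real.log_pos (by exact_mod_cast hn)
  have hT : 0 ≤ α * n ^ 2 / Real.log n := by positivity
  calc μ {ω | hitTime z ω ≤ ENNReal.ofReal (α * n ^ 2 / Real.log n)}
      ≤ μ {ω | ∃ k ≤ ⌊α * n ^ 2 / Real.log n⌋₊, ω k ∈ z} :=
        measure_mono fun ω h => exists_mem_of_hitTime_le h
    _ ≤ ENNReal.ofReal (Real.exp (hitExponent c p α n)) :=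
        measure_hit_le hμ (by omega) hz hρ (by linarith) (Nat.floor_le hT) (by positivity) hW
    _ < _ := by
        rw [ENNReal.ofReal_lt_ofReal_iff (by positivity), Real.rpow_def_of_pos hn0,
          Real.exp_lt_exp]
        have h1 : Real.log n * (-(α * (p + 2) - 2) ^ 2 / (8 * α)
            + (hitExponent c p α n / Real.log n - -(α * (p + 2) - 2) ^ 2 / (8 * α)
              + 1 / (n : ℝ))) = hitExponent c p α n + Real.log n / n := by
          rw [add_comm_sub, ← add_sub_assoc]
          field_simp
          ring
        rw [h1]
        linarith [div_pos hl hn0]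

end RWHitting
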